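/- Let n ≥ 1, s ∈ (0,1) and 1 < p < ∞ with sp > n, and set μ_s = s − n/p ∈ (0,1). There exists a constant C > 0 such that for every u ∈ C_c^∞(ℝⁿ), sup_{x∈ℝⁿ} |u(x)| + sup_{x≠y∈ℝⁿ} |u(x) − u(y)|/|x − y|^{μ_s} ≤ C ( ‖u‖_{L^p(ℝⁿ)} + ‖D^s u‖_{L^p(ℝⁿ;ℝⁿ)} ). (Fractional Morrey inequality: continuous embedding H^{s,p}(ℝⁿ) ↪ C^{0,μ_s}(ℝⁿ) in the supercritical case.) -/

import Mathlib

open MeasureTheory Filter ENNReal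

noncomputable section

/-- The normalization constant `c_{n,s}` of the Riesz fractional gradient. -/
def cns (n : ℕ) (s : ℝ) : ℝ :=
  ((n : ℝ) + s - 1) * Real.Gamma (((n : ℝ) + s - 1) / 2) /
    (Real.pi ^ ((n : ℝ) / 2) * (2 : ℝ) ^ (1 - s) * Real.Gamma ((1 - s) / 2))

/-- The Riesz fractional gradient
`D^s u (x) = c_{n,s} ∫ (u(x) - u(y))/|x-y|^{n+s} ⬝ (x-y)/|x-y| dy`. -/
def rieszGrad (n : ℕ) (s : ℝ) (u : EuclideanSpace ℝ (Fin n) → ℝ)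
    (x : EuclideanSpace ℝ (Fin n)) : EuclideanSpace ℝ (Fin n) :=
  cns n s • ∫ y, ((u x - u y) / ‖x - y‖ ^ ((n : ℝ) + s + 1)) • (x - y)

abbrev EE (n : ℕ) := EuclideanSpace ℝ (Fin n)

def ee (θ : ℝ) : ℂ := Complex.exp (((2 * Real.pi * θ : ℝ) : ℂ) * Complex.I)

lemma ee_norm (θ : ℝ) : ‖ee θ‖ = 1 := by
  unfold ee; exact Complex.norm_exp_ofReal_mul_I _

lemma ee_add (a b : ℝ) : ee (a + b) = ee a * ee b := by
  unfold ee; rw [← Complex.exp_add]; congr 1; push_cast; ring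

lemma ee_zero : ee 0 = 1 := by simp [ee]

lemma ee_cont : Continuous ee := by unfold ee; fun_prop

lemma ee_sub_bound (θ : ℝ) : ‖1 - ee θ‖ ≤ 2 * Real.pi * |θ| := by
  have := Real.norm_exp_I_mul_ofReal_sub_one_le (x := 2 * Real.pi * θ)
  rw [norm_sub_rev, ee, mul_comm]
  refine this.trans (le_of_eq ?_)
  rw [Real.norm_eq_abs, abs_mul, abs_of_pos (by positivity)]

lemma ee_sub_bound2 (θ : ℝ) : ‖1 - ee θ‖ ≤ 2 := by
  refine (norm_sub_le _ _).trans ?_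
  rw [ee_norm]; norm_num

lemma gauss_int {n : ℕ} {b : ℝ} (hb : 0 < b) :
    Integrable (fun w : EE n => Real.exp (-(b * ‖w‖ ^ 2))) := by
  have h := GaussianFourier.integrable_cexp_neg_mul_sq_norm_add (V := EE n) (b := (b : ℂ))
    (by simpa using hb) 0 0
  refine h.norm.congr (Eventually.of_forall fun w => ?_)
  simp only [Complex.norm_exp]
  congr 1
  simp [← Complex.ofReal_pow]

lemma gauss_int1 {n : ℕ} {b : ℝ} (hb : 0 < b) :
    Integrable (fun w : EE n => ‖w‖ * Real.exp (-(b * ‖w‖ ^ 2))) := by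
  have h := (gauss_int (n := n) (half_pos hb)).const_mul (1 + 2 / b)
  refine h.mono' (by fun_prop) (Eventually.of_forall fun w => ?_)
  rw [Real.norm_of_nonneg (by positivity)]
  set r := ‖w‖
  have h1 : r ≤ (1 + 2 / b) * Real.exp (b / 2 * r ^ 2) := by
    have h2 := Real.add_one_le_exp (b / 2 * r ^ 2)
    have h3 : r ≤ (1 + 2 / b) * (b / 2 * r ^ 2 + 1) := by
      have : (1 + 2 / b) * (b / 2 * r ^ 2 + 1) = b / 2 * r ^ 2 + 1 + r ^ 2 + 2 / b := by
        field_simp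
        try ring
      rw [this]
      have : 0 < 2 / b := by positivity
      nlinarith [sq_nonneg (r - 1), mul_nonneg hb.le (sq_nonneg r)]
    exact h3.trans (by gcongr)
  calc r * Real.exp (-(b * r ^ 2))
      ≤ ((1 + 2 / b) * Real.exp (b / 2 * r ^ 2)) * Real.exp (-(b * r ^ 2)) := by gcongr
    _ = (1 + 2 / b) * Real.exp (-(b / 2 * r ^ 2)) := by
        rw [mul_assoc, ← Real.exp_add]; congr 2; ring

lemma gauss0 {n : ℕ} {t : ℝ} (ht : 0 < t) (ξ : EE n) :
    ∫ w : EE n, ee (-(inner ℝ w ξ)) * ((Real.exp (-(Real.pi * t * ‖w‖ ^ 2)) : ℝ) : ℂ)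
      = (((t ^ (-((n : ℝ) / 2)) * Real.exp (-(Real.pi * ‖ξ‖ ^ 2 / t))) : ℝ) : ℂ) := by
  have hb : 0 < ((Real.pi * t : ℝ) : ℂ).re := by
    rw [Complex.ofReal_re]; positivity
  have h := GaussianFourier.integral_cexp_neg_mul_sq_norm_add (V := EE n)
    (b := ((Real.pi * t : ℝ) : ℂ)) hb (-2 * Real.pi * Complex.I) ξ
  have e1 : ∀ w : EE n, ee (-(inner ℝ w ξ)) * ((Real.exp (-(Real.pi * t * ‖w‖ ^ 2)) : ℝ) : ℂ)
      = Complex.exp (-((Real.pi * t : ℝ) : ℂ) * ‖w‖ ^ 2 + (-2 * Real.pi * Complex.I) * (inner ℝ ξ w : ℝ)) := by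
    intro w
    rw [ee, Complex.ofReal_exp, ← Complex.exp_add, real_inner_comm]
    congr 1; push_cast; ring
  simp_rw [e1, h]
  rw [Complex.ofReal_mul (t ^ _), Complex.ofReal_exp]
  congr 1
  · rw [finrank_euclideanSpace_fin, Real.rpow_neg ht.le, ← Real.inv_rpow ht.le,
      Complex.ofReal_cpow (by positivity)]
    congr 1
    · push_cast
      have : (Real.pi : ℂ) ≠ 0 := by exact_mod_cast Real.pi_ne_zero
      have : (t : ℂ) ≠ 0 := by exact_mod_cast ht.ne'
      field_simp
    · push_cast; ring
  · congr 1
    have : (Real.pi : ℂ) ≠ 0 := by exact_mod_cast Real.pi_ne_zero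
    have : (t : ℂ) ≠ 0 := by exact_mod_cast ht.ne'
    push_cast
    field_simp
    ring_nf
    simp [Complex.I_sq]
    try ring

lemma ee_hasFDeriv {n : ℕ} (ξ w h : EE n) :
    DifferentiableAt ℝ (fun w : EE n => ee (-(inner ℝ w ξ))) w ∧
    fderiv ℝ (fun w : EE n => ee (-(inner ℝ w ξ))) w h
      = (-(2 * Real.pi * (inner ℝ h ξ : ℝ)) * Complex.I) * ee (-(inner ℝ w ξ)) := by
  have h1 : HasFDerivAt (fun w : EE n => (((2 * Real.pi * -(inner ℝ w ξ) : ℝ) : ℂ)))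
      (Complex.ofRealCLM.comp ((2 * Real.pi) • (-(innerSL ℝ ξ)))) w := by
    have : HasFDerivAt (fun w : EE n => (2 * Real.pi * -(inner ℝ w ξ) : ℝ))
        ((2 * Real.pi) • (-(innerSL ℝ ξ))) w := by
      have h0 := (((innerSL ℝ ξ).hasFDerivAt (x := w)).neg).const_mul (2 * Real.pi)
      refine h0.congr_of_eventuallyEq (Eventually.of_forall fun z => ?_)
      simp [real_inner_comm]
    exact Complex.ofRealCLM.hasFDerivAt.comp w this
  have h2 := (h1.mul_const Complex.I).cexp
  refine ⟨h2.differentiableAt, ?_⟩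
  have := h2.fderiv
  unfold ee
  rw [this]
  simp [real_inner_comm]
  ring

lemma gs_hasFDeriv {n : ℕ} (b : ℝ) (w h : EE n) :
    DifferentiableAt ℝ (fun w : EE n => ((Real.exp (-(b * ‖w‖ ^ 2)) : ℝ) : ℂ)) w ∧
    fderiv ℝ (fun w : EE n => ((Real.exp (-(b * ‖w‖ ^ 2)) : ℝ) : ℂ)) w h
      = -(2 * b * (inner ℝ h w : ℝ)) * ((Real.exp (-(b * ‖w‖ ^ 2)) : ℝ) : ℂ) := by
  have h0 : HasFDerivAt (fun w : EE n => Real.exp (-(b * ‖w‖ ^ 2))) _ w := ((((hasStrictFDerivAt_norm_sq w).hasFDerivAt.const_mul b).neg).exp)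
  have h1 := Complex.ofRealCLM.hasFDerivAt.comp w h0
  refine ⟨h1.differentiableAt, ?_⟩
  have := h1.fderiv
  have h3 : (fun w : EE n => ((Real.exp (-(b * ‖w‖ ^ 2)) : ℝ) : ℂ)) = (⇑Complex.ofRealCLM ∘ fun w : EE n => Real.exp (-(b * ‖w‖ ^ 2))) := rfl
  rw [h3, this]
  simp [real_inner_comm]
  ring

lemma gauss_meas_int {n : ℕ} {b : ℝ} (hb : 0 < b) (ξ h : EE n) :
    Integrable (fun w : EE n => ee (-(inner ℝ w ξ)) *
      ((inner ℝ h w * Real.exp (-(b * ‖w‖ ^ 2)) : ℝ) : ℂ)) := by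
  refine ((gauss_int1 (n := n) hb).const_mul ‖h‖).mono' ?_ (Eventually.of_forall fun w => ?_)
  · have := ee_cont; fun_prop
  · rw [norm_mul, ee_norm, one_mul, Complex.norm_real, norm_mul, Real.norm_of_nonneg (Real.exp_pos _).le,
      ← mul_assoc]
    gcongr
    exact norm_inner_le_norm h w

lemma gauss1 {n : ℕ} {t : ℝ} (ht : 0 < t) (ξ h : EE n) :
    ∫ w : EE n, ee (-(inner ℝ w ξ)) *
        ((inner ℝ h w * Real.exp (-(Real.pi * t * ‖w‖ ^ 2)) : ℝ) : ℂ)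
      = -Complex.I * (((t ^ (-((n : ℝ) / 2) - 1) * inner ℝ h ξ *
          Real.exp (-(Real.pi * ‖ξ‖ ^ 2 / t))) : ℝ) : ℂ) := by
  have hb : 0 < Real.pi * t := by positivity
  have ec := ee_cont
  have key := integral_mul_fderiv_eq_neg_fderiv_mul_of_integrable (μ := (volume : Measure (EE n)))
    (𝕜 := ℂ)
    (f := fun w : EE n => ee (-(inner ℝ w ξ)))
    (g := fun w : EE n => ((Real.exp (-(Real.pi * t * ‖w‖ ^ 2)) : ℝ) : ℂ)) (v := h)
  have i0 : Integrable (fun w : EE n => ee (-(inner ℝ w ξ)) *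
      ((Real.exp (-(Real.pi * t * ‖w‖ ^ 2)) : ℝ) : ℂ)) := by
    refine (gauss_int (n := n) hb).mono' (by fun_prop) (Eventually.of_forall fun w => ?_)
    rw [norm_mul, ee_norm, one_mul, Complex.norm_real, Real.norm_of_nonneg (Real.exp_pos _).le]
  simp only [fun w => (ee_hasFDeriv ξ w h).2, fun w => (gs_hasFDeriv (Real.pi * t) w h).2] at key
  have key := key ?_ ?_ i0 (fun w _ => (ee_hasFDeriv ξ w h).1) (fun w _ => (gs_hasFDeriv _ w h).1)
  · have e1 : ∀ w : EE n, ee (-(inner ℝ w ξ)) * (-(2 * ((Real.pi * t : ℝ) : ℂ) * (inner ℝ h w : ℝ)) *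
        ((Real.exp (-(Real.pi * t * ‖w‖ ^ 2)) : ℝ) : ℂ)) =
        (-(2 * ((Real.pi * t : ℝ) : ℂ))) * (ee (-(inner ℝ w ξ)) *
        ((inner ℝ h w * Real.exp (-(Real.pi * t * ‖w‖ ^ 2)) : ℝ) : ℂ)) := by
      intro w; push_cast; ring
    have e2 : ∀ w : EE n, (-(2 * Real.pi * (inner ℝ h ξ : ℝ)) * Complex.I) * ee (-(inner ℝ w ξ)) *
        ((Real.exp (-(Real.pi * t * ‖w‖ ^ 2)) : ℝ) : ℂ) =
        (-(2 * Real.pi * (inner ℝ h ξ : ℝ)) * Complex.I) * (ee (-(inner ℝ w ξ)) *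
        ((Real.exp (-(Real.pi * t * ‖w‖ ^ 2)) : ℝ) : ℂ)) := by
      intro w; ring
    simp_rw [e1, e2, integral_const_mul, gauss0 ht] at key
    have hpi : (Real.pi : ℂ) ≠ 0 := by exact_mod_cast Real.pi_ne_zero
    have ht' : (t : ℂ) ≠ 0 := by exact_mod_cast ht.ne'
    have : (-(2 * ((Real.pi * t : ℝ) : ℂ))) ≠ 0 := by
      push_cast
      simp [hpi, ht']
    apply mul_left_cancel₀ this
    rw [key, Real.rpow_sub_one ht.ne']
    push_cast
    field_simp
  · refine (i0.const_mul (-(2 * Real.pi * (inner ℝ h ξ : ℝ)) * Complex.I)).congr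
      (Eventually.of_forall fun w => ?_)
    simp only; ring
  · refine ((gauss_meas_int hb ξ h).const_mul (-(2 * ((Real.pi * t : ℝ) : ℂ)))).congr
      (Eventually.of_forall fun w => ?_)
    simp only; push_cast; ring

lemma minint {μ d : ℝ} (h0 : 0 < μ) (h1 : μ < 1) (hd : 0 < d) :
    IntegrableOn (fun r : ℝ => r ^ (μ - 1) * min 1 (d / r)) (Set.Ioi 0) ∧
    ∫ r in Set.Ioi (0 : ℝ), r ^ (μ - 1) * min 1 (d / r) = d ^ μ * (1 / μ + 1 / (1 - μ)) := by
  have e1 : Set.EqOn (fun r : ℝ => r ^ (μ - 1)) (fun r : ℝ => r ^ (μ - 1) * min 1 (d / r))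
      (Set.Ioc 0 d) := by
    intro r hr
    have : 1 ≤ d / r := by rw [le_div_iff₀ hr.1]; linarith [hr.2]
    simp [min_eq_left this]
  have e2 : Set.EqOn (fun r : ℝ => d * r ^ (μ - 2)) (fun r : ℝ => r ^ (μ - 1) * min 1 (d / r))
      (Set.Ioi d) := by
    intro r hr
    have hr' : d < r := hr
    have hr0 : 0 < r := hd.trans hr
    have : d / r ≤ 1 := by rw [div_le_one hr0]; exact hr'.le
    simp only [min_eq_right this]
    rw [show μ - 2 = (μ - 1) - 1 by ring, Real.rpow_sub_one hr0.ne']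
    ring
  have i1 : IntegrableOn (fun r : ℝ => r ^ (μ - 1)) (Set.Ioc 0 d) := by
    have := intervalIntegral.intervalIntegrable_rpow' (a := 0) (b := d) (r := μ - 1) (by linarith)
    rwa [intervalIntegrable_iff_integrableOn_Ioc_of_le hd.le] at this
  have i2 : IntegrableOn (fun r : ℝ => d * r ^ (μ - 2)) (Set.Ioi d) :=
    (integrableOn_Ioi_rpow_of_lt (by linarith) hd).const_mul d
  have j1 := i1.congr_fun e1 measurableSet_Ioc
  have j2 := i2.congr_fun e2 measurableSet_Ioi
  have hu : Set.Ioi (0 : ℝ) = Set.Ioc 0 d ∪ Set.Ioi d := (Set.Ioc_union_Ioi_eq_Ioi hd.le).symm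
  rw [hu]
  refine ⟨j1.union j2, ?_⟩
  rw [setIntegral_union (Set.Ioc_disjoint_Ioi le_rfl) measurableSet_Ioi j1 j2,
    ← setIntegral_congr_fun measurableSet_Ioc e1, ← setIntegral_congr_fun measurableSet_Ioi e2,
    integral_const_mul, integral_Ioi_rpow_of_lt (by linarith) hd,
    ← intervalIntegral.integral_of_le hd.le, integral_rpow (Or.inl (by linarith))]
  rw [show μ - 1 + 1 = μ by ring, Real.zero_rpow h0.ne', show μ - 2 + 1 = μ - 1 by ring,
    Real.rpow_sub_one hd.ne']
  have : μ - 1 ≠ 0 := by linarith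
  have : 1 - μ ≠ 0 := by linarith
  rw [show μ - 1 = - (1 - μ) by ring]
  field_simp
  ring

lemma kern_int {n : ℕ} (hn : 1 ≤ n) {s : ℝ} (hs0 : 0 < s) (hs1 : s < 1) :
    Integrable (fun h : EE n => min 1 ‖h‖ * (‖h‖ / ‖h‖ ^ ((n : ℝ) + s + 1))) := by
  haveI : Nonempty (Fin n) := ⟨⟨0, hn⟩⟩
  have := integrable_fun_norm_addHaar (volume : Measure (EE n))
    (f := fun r : ℝ => min 1 r * (r / r ^ ((n : ℝ) + s + 1)))
  rw [this]
  refine (minint (μ := 1 - s) (d := 1) (by linarith) (by linarith) one_pos).1.congr_fun ?_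
    measurableSet_Ioi
  intro r hr
  have hr : 0 < r := hr
  simp only [smul_eq_mul, finrank_euclideanSpace_fin]
  have e1 : min 1 (1 / r) = min 1 r / r := by
    rw [← min_div_div_right hr.le, div_self hr.ne', min_comm]
  rw [e1, ← Real.rpow_natCast, Nat.cast_sub hn]
  have : r ^ (1 - s - 1) / r = r ^ ((n : ℝ) - (1 : ℕ)) * (r / r ^ ((n : ℝ) + s + 1)) := by
    nth_rewrite 2 [← Real.rpow_one r]
    nth_rewrite 4 [← Real.rpow_one r]
    rw [← Real.rpow_sub hr, ← Real.rpow_sub hr, ← Real.rpow_add hr]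
    congr 1; push_cast; ring
  calc _ = min 1 r * (r ^ (1 - s - 1) / r) := by ring
    _ = _ := by rw [this]; ring

lemma one_sub_ee_bound (a b : ℝ) (ha : 0 ≤ a) (hb : 0 ≤ b) (θ : ℝ) (h : |θ| ≤ a * b) :
    ‖1 - ee θ‖ ≤ 2 * Real.pi * (1 + b) * min 1 a := by
  have hpi := Real.pi_gt_three
  rcases le_total 1 a with h1 | h1
  · rw [min_eq_left h1]
    refine (ee_sub_bound2 θ).trans ?_
    nlinarith
  · rw [min_eq_right h1]
    refine (ee_sub_bound θ).trans ?_
    have : a * b ≤ (1 + b) * a := by nlinarith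
    calc 2 * Real.pi * |θ| ≤ 2 * Real.pi * ((1 + b) * a) := by gcongr; linarith
      _ = _ := by ring

/-- the symbol integrand -/
def symK (n : ℕ) (s : ℝ) (h ξ : EE n) : ℂ :=
  ((inner ℝ h ξ / ‖h‖ ^ ((n : ℝ) + s + 1) : ℝ) : ℂ) * (1 - ee (-(inner ℝ h ξ)))

lemma symK_meas (n : ℕ) (s : ℝ) : Measurable (fun q : EE n × EE n => symK n s q.1 q.2) := by
  unfold symK
  have := ee_cont.measurable
  fun_prop

lemma symK_bound (n : ℕ) (s : ℝ) (h ξ : EE n) :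
    ‖symK n s h ξ‖ ≤ (min 1 ‖h‖ * (‖h‖ / ‖h‖ ^ ((n : ℝ) + s + 1))) *
      (2 * Real.pi * (1 + ‖ξ‖) * ‖ξ‖) := by
  unfold symK
  have h1 := one_sub_ee_bound ‖h‖ ‖ξ‖ (norm_nonneg _) (norm_nonneg _) (-(inner ℝ h ξ))
    (by rw [abs_neg]; exact abs_real_inner_le_norm h ξ)
  rw [norm_mul, Complex.norm_real, norm_div, Real.norm_of_nonneg (by positivity : 0 ≤ ‖h‖ ^ ((n : ℝ) + s + 1))]
  have h2 : ‖(inner ℝ h ξ : ℝ)‖ ≤ ‖h‖ * ‖ξ‖ := norm_inner_le_norm h ξ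
  calc _ ≤ ((‖h‖ * ‖ξ‖) / ‖h‖ ^ ((n : ℝ) + s + 1)) * (2 * Real.pi * (1 + ‖ξ‖) * min 1 ‖h‖) := by
        gcongr
    _ = _ := by ring

lemma symK_int {n : ℕ} (hn : 1 ≤ n) {s : ℝ} (hs0 : 0 < s) (hs1 : s < 1) (ξ : EE n) :
    Integrable (fun h => symK n s h ξ) := by
  refine ((kern_int hn hs0 hs1).mul_const (2 * Real.pi * (1 + ‖ξ‖) * ‖ξ‖)).mono'
    ?_ (Eventually.of_forall fun h => symK_bound n s h ξ)
  exact ((symK_meas n s).comp (measurable_id.prodMk measurable_const)).aestronglyMeasurable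

lemma inv_gamma {s b : ℝ} (hs1 : s < 1) (hb : 0 < b) :
    ∫ t in Set.Ioi (0 : ℝ), t ^ ((s - 3) / 2) * Real.exp (-(b / t)) =
      (1 / b) ^ ((1 - s) / 2) * Real.Gamma ((1 - s) / 2) := by
  rw [← Real.integral_rpow_mul_exp_neg_mul_Ioi (by linarith) hb]
  rw [← integral_comp_rpow_Ioi (fun t => t ^ ((s - 3) / 2) * Real.exp (-(b / t)))
    (p := -1) (by norm_num)]
  refine setIntegral_congr_fun measurableSet_Ioi fun v hv => ?_
  have hv : 0 < v := hv
  simp only [smul_eq_mul, abs_neg, abs_one, one_mul]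
  rw [← Real.rpow_mul hv.le, ← mul_assoc, ← Real.rpow_add hv, Real.rpow_neg_one, div_inv_eq_mul]
  congr 2
  ring

lemma gamma_rep {n : ℕ} {a : ℝ} (ha : 0 < a) {h : EE n} (hh : h ≠ 0) :
    ∫ t in Set.Ioi (0 : ℝ), t ^ (a / 2 - 1) * Real.exp (-(Real.pi * t * ‖h‖ ^ 2)) =
      ((1 / Real.pi) ^ (a / 2) * Real.Gamma (a / 2)) / ‖h‖ ^ a := by
  have hp : 0 < ‖h‖ := norm_pos_iff.mpr hh
  have := Real.integral_rpow_mul_exp_neg_mul_Ioi (a := a / 2) (r := Real.pi * ‖h‖ ^ 2)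
    (by positivity) (by positivity)
  have e : ∀ t : ℝ, Real.pi * t * ‖h‖ ^ 2 = Real.pi * ‖h‖ ^ 2 * t := fun t => by ring
  simp_rw [e, this]
  rw [one_div, mul_inv, Real.mul_rpow (by positivity) (by positivity), Real.inv_rpow (by positivity) (a / 2),
    Real.inv_rpow (by positivity) (a / 2), one_div, Real.inv_rpow (by positivity) (a / 2), ← Real.rpow_natCast, ← Real.rpow_mul hp.le]
  rw [show ((2 : ℕ) : ℝ) * (a / 2) = a by push_cast; ring]
  field_simp

lemma gamma_rep_int {n : ℕ} {a : ℝ} (ha : 0 < a) {h : EE n} (hh : h ≠ 0) :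
    IntegrableOn (fun t : ℝ => t ^ (a / 2 - 1) * Real.exp (-(Real.pi * t * ‖h‖ ^ 2)))
      (Set.Ioi 0) := by
  have hp : 0 < ‖h‖ := norm_pos_iff.mpr hh
  have := integrableOn_rpow_mul_exp_neg_mul_rpow (s := a / 2 - 1) (p := 1) (b := Real.pi * ‖h‖ ^ 2)
    (by linarith) one_pos (by positivity)
  refine this.congr_fun (fun t ht => ?_) measurableSet_Ioi
  simp only [Real.rpow_one]
  congr 2; ring

lemma ae_ne_zero {n : ℕ} (hn : 1 ≤ n) : ∀ᵐ h : EE n, h ≠ 0 := by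
  have : Nonempty (Fin n) := ⟨⟨0, hn⟩⟩
  rw [ae_iff]; simp

lemma symM {n : ℕ} (hn : 1 ≤ n) {s : ℝ} (hs0 : 0 < s) (hs1 : s < 1) :
    ∃ c : ℝ, 0 < c ∧ ∀ ξ : EE n, ∫ h, symK n s h ξ = Complex.I * ((c * ‖ξ‖ ^ (s + 1) : ℝ) : ℂ) := by
  set a : ℝ := (n : ℝ) + s + 1 with ha_def
  have ha : 0 < a := by positivity
  set g : ℝ := (1 / Real.pi) ^ (a / 2) * Real.Gamma (a / 2) with hg_def
  have hg : 0 < g := by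
    have := Real.Gamma_pos_of_pos (half_pos ha)
    positivity
  have hG : 0 < Real.Gamma ((1 - s) / 2) := Real.Gamma_pos_of_pos (by linarith)
  refine ⟨g⁻¹ * ((1 / Real.pi) ^ ((1 - s) / 2) * Real.Gamma ((1 - s) / 2)), by positivity, fun ξ => ?_⟩
  by_cases hξ : ξ = 0
  · subst hξ
    simp [symK, Real.zero_rpow (by linarith : s + 1 ≠ 0)]
  have hξp : 0 < ‖ξ‖ := norm_pos_iff.mpr hξ
  have hec := ee_cont.measurable
  let F : EE n → ℝ → ℂ := fun h t => ((t ^ (a / 2 - 1) * Real.exp (-(Real.pi * t * ‖h‖ ^ 2)) : ℝ) : ℂ) *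
    (((inner ℝ h ξ : ℝ) : ℂ) * (1 - ee (-(inner ℝ h ξ))))
  have hF1 : ∀ h : EE n, h ≠ 0 → ∫ t in Set.Ioi (0 : ℝ), F h t = (g : ℂ) * symK n s h ξ := by
    intro h hh
    simp only [F]
    rw [integral_mul_const, integral_complex_ofReal, gamma_rep ha hh, ← hg_def]
    simp only [symK, ← ha_def]
    push_cast
    ring
  have hFn : ∀ h : EE n, h ≠ 0 → ∫ t in Set.Ioi (0 : ℝ), ‖F h t‖ = g * ‖symK n s h ξ‖ := by
    intro h hh
    have : ∀ t ∈ Set.Ioi (0 : ℝ), ‖F h t‖ = (t ^ (a / 2 - 1) * Real.exp (-(Real.pi * t * ‖h‖ ^ 2))) *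
      ‖(((inner ℝ h ξ : ℝ) : ℂ) * (1 - ee (-(inner ℝ h ξ))))‖ := by
      intro t ht
      have ht : 0 < t := ht
      simp only [F]
      rw [norm_mul, Complex.norm_real, Real.norm_of_nonneg (by positivity)]
    rw [setIntegral_congr_fun measurableSet_Ioi this, integral_mul_const, gamma_rep ha hh, ← hg_def]
    simp only [symK, ← ha_def]
    rw [norm_mul, norm_mul, Complex.norm_real, Complex.norm_real, norm_div,
      Real.norm_of_nonneg (by positivity : 0 ≤ ‖h‖ ^ a)]
    ring
  have hFint : Integrable (Function.uncurry F) ((volume : Measure (EE n)).prod (volume.restrict (Set.Ioi (0 : ℝ)))) := by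
    rw [integrable_prod_iff]
    · constructor
      · filter_upwards [ae_ne_zero hn] with h hh
        have h0 : Integrable (fun t : ℝ => ((t ^ (a / 2 - 1) * Real.exp (-(Real.pi * t * ‖h‖ ^ 2)) : ℝ) : ℂ))
          (volume.restrict (Set.Ioi 0)) := (gamma_rep_int ha hh).ofReal
        exact h0.mul_const (((inner ℝ h ξ : ℝ) : ℂ) * (1 - ee (-(inner ℝ h ξ))))
      · refine ((symK_int hn hs0 hs1 ξ).norm.const_mul g).congr ?_
        filter_upwards [ae_ne_zero hn] with h hh
        exact (hFn h hh).symm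
    · apply Measurable.aestronglyMeasurable
      simp only [F, Function.uncurry_def]
      fun_prop
  have hswap := integral_integral_swap hFint
  have hL : ∫ h, ∫ t in Set.Ioi (0 : ℝ), F h t = (g : ℂ) * ∫ h, symK n s h ξ := by
    rw [← integral_const_mul]
    apply integral_congr_ae
    filter_upwards [ae_ne_zero hn] with h hh using hF1 h hh
  have hR : ∀ t ∈ Set.Ioi (0 : ℝ), ∫ h, F h t =
      Complex.I * ((‖ξ‖ ^ 2 * (t ^ ((s - 3) / 2) * Real.exp (-(Real.pi * ‖ξ‖ ^ 2 / t))) : ℝ) : ℂ) := by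
    intro t ht
    have ht : 0 < t := ht
    have e : ∀ h : EE n, F h t = ((t ^ (a / 2 - 1) : ℝ) : ℂ) *
      (ee (-(inner ℝ h (0 : EE n))) * ((inner ℝ ξ h * Real.exp (-(Real.pi * t * ‖h‖ ^ 2)) : ℝ) : ℂ)
       - ee (-(inner ℝ h ξ)) * ((inner ℝ ξ h * Real.exp (-(Real.pi * t * ‖h‖ ^ 2)) : ℝ) : ℂ)) := by
      intro h
      simp only [F, inner_zero_right, neg_zero, ee_zero, real_inner_comm ξ h]
      push_cast
      ring
    simp_rw [e]
    have hb : 0 < Real.pi * t := by positivity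
    rw [integral_const_mul, integral_sub (gauss_meas_int hb _ _) (gauss_meas_int hb _ _),
      gauss1 ht, gauss1 ht, inner_zero_right, real_inner_self_eq_norm_sq]
    have : t ^ ((s - 3) / 2) = t ^ (a / 2 - 1) * t ^ (-((n : ℝ) / 2) - 1) := by
      rw [← Real.rpow_add ht]; congr 1; rw [ha_def]; ring
    rw [this]
    push_cast
    ring
  rw [hL, setIntegral_congr_fun measurableSet_Ioi hR, integral_const_mul, integral_complex_ofReal,
    integral_const_mul, inv_gamma hs1 (by positivity)] at hswap
  have hgc : (g : ℂ) ≠ 0 := by exact_mod_cast hg.ne'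
  apply mul_left_cancel₀ hgc
  rw [hswap]
  have : ‖ξ‖ ^ 2 * (1 / (Real.pi * ‖ξ‖ ^ 2)) ^ ((1 - s) / 2) = (1 / Real.pi) ^ ((1 - s) / 2) * ‖ξ‖ ^ (s + 1) := by
    rw [show 1 / (Real.pi * ‖ξ‖ ^ 2) = (1 / Real.pi) * (‖ξ‖ ^ 2)⁻¹ by field_simp,
      Real.mul_rpow (by positivity) (by positivity), ← Real.rpow_natCast, ← Real.rpow_neg hξp.le,
      ← Real.rpow_mul hξp.le, mul_left_comm, ← Real.rpow_add hξp]
    congr 2; push_cast; ring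
  rw [← mul_assoc, this]
  push_cast
  field_simp

structure FData {n : ℕ} (u : EE n → ℝ) (f : EE n → ℂ) : Prop where
  cont : Continuous f
  int : ∀ k : ℕ, Integrable (fun ξ => ‖ξ‖ ^ k * ‖f ξ‖)
  rep : ∀ z, (u z : ℂ) = ∫ ξ, ee (inner ℝ ξ z) * f ξ

lemma fourier_data {n : ℕ} (u : EE n → ℝ) (hu : ContDiff ℝ (⊤ : ℕ∞) u) (hc : HasCompactSupport u) :
    ∃ f, FData u f := by
  have hc' : HasCompactSupport (fun z => (u z : ℂ)) := by
    exact hc.comp_left (g := fun r : ℝ => (r : ℂ)) (by simp)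
  have hu' : ContDiff ℝ (⊤ : ℕ∞) (fun z => (u z : ℂ)) := Complex.ofRealCLM.contDiff.comp hu
  let φ : SchwartzMap (EE n) ℂ := hc'.toSchwartzMap hu'
  have hφ : ∀ z, φ z = u z := fun z => rfl
  let ψ : SchwartzMap (EE n) ℂ := FourierTransform.fourier φ
  refine ⟨ψ, ψ.continuous, fun k => ψ.integrable_pow_mul volume k, fun z => ?_⟩
  have h1 : FourierTransformInv.fourierInv ψ = φ := FourierTransform.fourierInv_fourier_eq φ
  have h2 : φ z = FourierTransformInv.fourierInv (ψ : EE n → ℂ) z := by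
    rw [← SchwartzMap.fourierInv_coe, h1]
  rw [← hφ, h2, Real.fourierInv_eq']
  rfl

lemma lip_data {n : ℕ} (u : EE n → ℝ) (hu : ContDiff ℝ (⊤ : ℕ∞) u) (hc : HasCompactSupport u) :
    ∃ C, 0 ≤ C ∧ ∀ z h, |u z - u (z - h)| ≤ C * min 1 ‖h‖ := by
  obtain ⟨L, hL⟩ := ContDiff.lipschitzWith_of_hasCompactSupport hc hu (by simp)
  obtain ⟨B, hB⟩ := hu.continuous.bounded_above_of_compact_support hc
  have hB0 : 0 ≤ B := (norm_nonneg _).trans (hB 0)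
  refine ⟨L + 2 * B, by positivity, fun z h => ?_⟩
  rcases le_total 1 ‖h‖ with h1 | h1
  · rw [min_eq_left h1]
    have := abs_sub (u z) (u (z - h))
    have h2 := hB z
    have h3 := hB (z - h)
    rw [Real.norm_eq_abs] at h2 h3
    have : (0 : ℝ) ≤ L := L.2
    linarith
  · rw [min_eq_right h1]
    have := hL.dist_le_mul z (z - h)
    rw [Real.dist_eq, dist_eq_norm, _root_.sub_sub_cancel] at this
    refine this.trans ?_
    gcongr
    linarith

def D0 (n : ℕ) (s : ℝ) (u : EE n → ℝ) (z : EE n) : EE n :=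
  ∫ h, ((u z - u (z - h)) / ‖h‖ ^ ((n : ℝ) + s + 1)) • h

def AA (n : ℕ) (s : ℝ) (u : EE n → ℝ) (t : ℝ) (x : EE n) : ℝ :=
  ∫ z, inner ℝ (D0 n s u z) (x - z) * Real.exp (-(Real.pi * t * ‖x - z‖ ^ 2))

lemma D0_int {n : ℕ} (hn : 1 ≤ n) {s : ℝ} (hs0 : 0 < s) (hs1 : s < 1) (u : EE n → ℝ)
    (hu : ContDiff ℝ (⊤ : ℕ∞) u) (hc : HasCompactSupport u) (z : EE n) :
    Integrable (fun h : EE n => ((u z - u (z - h)) / ‖h‖ ^ ((n : ℝ) + s + 1)) • h) := by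
  obtain ⟨C, hC0, hC⟩ := lip_data u hu hc
  have hum := hu.continuous.measurable
  refine ((kern_int hn hs0 hs1).const_mul C).mono' ?_ (Eventually.of_forall fun h => ?_)
  · apply Measurable.aestronglyMeasurable
    fun_prop
  · rw [norm_smul, norm_div, Real.norm_of_nonneg (by positivity : 0 ≤ ‖h‖ ^ ((n : ℝ) + s + 1)), Real.norm_eq_abs]
    calc _ ≤ (C * min 1 ‖h‖) / ‖h‖ ^ ((n : ℝ) + s + 1) * ‖h‖ := by gcongr; exact hC z h
      _ = _ := by ring

lemma f_int {n : ℕ} {u : EE n → ℝ} {f : EE n → ℂ} (hf : FData u f) : Integrable f := by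
  have := hf.int 0
  simp only [pow_zero, one_mul] at this
  exact (integrable_norm_iff hf.cont.aestronglyMeasurable).1 this

lemma BB {n : ℕ} (u : EE n → ℝ) {f : EE n → ℂ} (hf : FData u f) {t : ℝ} (ht : 0 < t) (x h : EE n) :
    ((∫ z, (u z - u (z - h)) * (inner ℝ h (x - z) * Real.exp (-(Real.pi * t * ‖x - z‖ ^ 2))) : ℝ) : ℂ)
    = ∫ ξ, (f ξ * ee (inner ℝ ξ x) * (1 - ee (-(inner ℝ h ξ)))) *
      (-Complex.I * (((t ^ (-((n : ℝ) / 2) - 1) * inner ℝ h ξ *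
          Real.exp (-(Real.pi * ‖ξ‖ ^ 2 / t))) : ℝ) : ℂ)) := by
  have hb : 0 < Real.pi * t := by positivity
  have hec := ee_cont
  have hfc := hf.cont
  rw [← integral_complex_ofReal, ← integral_sub_left_eq_self _ _ x]
  have e1 : ∀ w : EE n, (((u (x - w) - u (x - w - h)) * (inner ℝ h (x - (x - w)) *
      Real.exp (-(Real.pi * t * ‖x - (x - w)‖ ^ 2))) : ℝ) : ℂ) =
      ∫ ξ, (f ξ * ee (inner ℝ ξ x) * (1 - ee (-(inner ℝ h ξ)))) *
        (ee (-(inner ℝ w ξ)) * ((inner ℝ h w * Real.exp (-(Real.pi * t * ‖w‖ ^ 2)) : ℝ) : ℂ)) := by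
    intro w
    have hi : ∀ z, Integrable (fun ξ => ee (inner ℝ ξ z) * f ξ) := fun z => by
      refine (f_int hf).norm.mono' (by fun_prop) (Eventually.of_forall fun ξ => ?_)
      rw [norm_mul, ee_norm, one_mul]
    rw [_root_.sub_sub_cancel, Complex.ofReal_mul, Complex.ofReal_sub, hf.rep, hf.rep,
      ← integral_sub (hi _) (hi _), ← integral_mul_const]
    congr 1
    ext ξ
    have a1 : ee (inner ℝ ξ (x - w)) = ee (inner ℝ ξ x) * ee (-(inner ℝ w ξ)) := by
      rw [← ee_add, inner_sub_right, real_inner_comm w ξ]; rfl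
    have a2 : ee (inner ℝ ξ (x - w - h)) = ee (inner ℝ ξ x) * ee (-(inner ℝ w ξ)) * ee (-(inner ℝ h ξ)) := by
      rw [← ee_add, ← ee_add, inner_sub_right, inner_sub_right, real_inner_comm w ξ, real_inner_comm h ξ]; rfl
    rw [a1, a2]
    ring
  simp_rw [e1]
  rw [integral_integral_swap]
  · congr 1
    ext ξ
    rw [integral_const_mul, gauss1 ht]
  · have := (((gauss_int1 (n := n) hb).const_mul ‖h‖)).mul_prod ((f_int hf).norm.mul_const 2)
    refine this.mono' ?_ (Eventually.of_forall fun q => ?_)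
    · apply Continuous.aestronglyMeasurable
      simp only [Function.uncurry_def]
      fun_prop
    · simp only [Function.uncurry_def]
      rw [norm_mul, norm_mul, norm_mul, norm_mul, ee_norm, ee_norm, one_mul, mul_one, Complex.norm_real, norm_mul,
        Real.norm_of_nonneg (Real.exp_pos _).le, mul_comm]
      rw [← mul_assoc ‖h‖]
      gcongr
      · exact norm_inner_le_norm h q.1
      · exact ee_sub_bound2 _

lemma AA_formula {n : ℕ} (hn : 1 ≤ n) {s : ℝ} (hs0 : 0 < s) (hs1 : s < 1) (u : EE n → ℝ)
    (hu : ContDiff ℝ (⊤ : ℕ∞) u) (hc : HasCompactSupport u) {f : EE n → ℂ} (hf : FData u f)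
    {t : ℝ} (ht : 0 < t) (x : EE n) :
    (AA n s u t x : ℂ) = -Complex.I * ((t ^ (-((n : ℝ) / 2) - 1) : ℝ) : ℂ) *
      ∫ ξ, f ξ * ee (inner ℝ ξ x) * ((Real.exp (-(Real.pi * ‖ξ‖ ^ 2 / t)) : ℝ) : ℂ) *
        ∫ h, symK n s h ξ := by
  obtain ⟨C, hC0, hC⟩ := lip_data u hu hc
  have hb : 0 < Real.pi * t := by positivity
  have hum := hu.continuous.measurable
  have hec := ee_cont.measurable
  have hfm := hf.cont.measurable
  have hsK := symK_meas n s
  let F : EE n → EE n → ℝ := fun z h => ((u z - u (z - h)) * (inner ℝ h (x - z) *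
    Real.exp (-(Real.pi * t * ‖x - z‖ ^ 2)))) / ‖h‖ ^ ((n : ℝ) + s + 1)
  have hF1 : ∀ z, inner ℝ (D0 n s u z) (x - z) * Real.exp (-(Real.pi * t * ‖x - z‖ ^ 2))
      = ∫ h, F z h := by
    intro z
    rw [D0, real_inner_comm, ← integral_inner (D0_int hn hs0 hs1 u hu hc z), ← integral_mul_const]
    congr 1; ext h
    simp only [F, inner_smul_right, real_inner_comm h]
    ring
  have hFint : Integrable (Function.uncurry F) ((volume : Measure (EE n)).prod volume) := by
    have g1 : Integrable (fun z : EE n => ‖x - z‖ * Real.exp (-(Real.pi * t * ‖x - z‖ ^ 2))) :=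
      (gauss_int1 (n := n) hb).comp_sub_left x
    have := g1.mul_prod ((kern_int hn hs0 hs1).const_mul C)
    refine this.mono' ?_ (Eventually.of_forall fun q => ?_)
    · apply Measurable.aestronglyMeasurable
      simp only [F, Function.uncurry_def]
      fun_prop
    · simp only [F, Function.uncurry_def]
      rw [norm_div, norm_mul, norm_mul, Real.norm_of_nonneg (Real.exp_pos _).le,
        Real.norm_of_nonneg (by positivity : 0 ≤ ‖q.2‖ ^ ((n : ℝ) + s + 1))]
      calc _ ≤ ((C * min 1 ‖q.2‖) * ((‖q.2‖ * ‖x - q.1‖) * Real.exp (-(Real.pi * t * ‖x - q.1‖ ^ 2)))) /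
            ‖q.2‖ ^ ((n : ℝ) + s + 1) := by
            gcongr
            · exact hC q.1 q.2
            · exact norm_inner_le_norm _ _
        _ = _ := by ring
  have hA : AA n s u t x = ∫ h, ∫ z, F z h := by
    rw [← integral_integral_swap hFint]
    simp only [AA, hF1]
  have hB : ∀ h, ((∫ z, F z h : ℝ) : ℂ) = ∫ ξ, (-Complex.I * ((t ^ (-((n : ℝ) / 2) - 1) : ℝ) : ℂ)) *
      (f ξ * ee (inner ℝ ξ x) * ((Real.exp (-(Real.pi * ‖ξ‖ ^ 2 / t)) : ℝ) : ℂ) * symK n s h ξ) := by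
    intro h
    simp only [F]
    rw [integral_div, Complex.ofReal_div, BB u hf ht x h, ← integral_div]
    congr 1; ext ξ
    simp only [symK]
    push_cast
    ring
  rw [hA, ← integral_complex_ofReal]
  simp_rw [hB]
  rw [integral_integral_swap]
  · rw [← integral_const_mul]
    congr 1; ext ξ
    rw [integral_const_mul, integral_const_mul]
  · have i1 : Integrable (fun ξ => 2 * Real.pi * (‖ξ‖ ^ 1 * ‖f ξ‖ + ‖ξ‖ ^ 2 * ‖f ξ‖)) :=
      ((hf.int 1).add (hf.int 2)).const_mul _
    have i2 := ((kern_int hn hs0 hs1).mul_prod i1).const_mul (t ^ (-((n : ℝ) / 2) - 1))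
    refine i2.mono' ?_ (Eventually.of_forall fun q => ?_)
    · apply Measurable.aestronglyMeasurable
      simp only [Function.uncurry_def]
      fun_prop
    · simp only [Function.uncurry_def]
      rw [norm_mul, norm_mul, norm_mul, norm_mul, norm_mul, ee_norm, norm_neg, Complex.norm_I, one_mul, mul_one,
        Complex.norm_real, Complex.norm_real, Real.norm_of_nonneg (Real.exp_pos _).le,
        Real.norm_of_nonneg (by positivity : 0 ≤ t ^ (-((n : ℝ) / 2) - 1))]
      have he : Real.exp (-(Real.pi * ‖q.2‖ ^ 2 / t)) ≤ 1 := by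
        rw [Real.exp_le_one_iff, neg_nonpos]; positivity
      have := symK_bound n s q.1 q.2
      refine mul_le_mul_of_nonneg_left ?_ (by positivity)
      calc _ ≤ ‖f q.2‖ * 1 * _ := mul_le_mul (mul_le_mul_of_nonneg_left he (norm_nonneg _)) this
              (norm_nonneg _) (by positivity)
        _ = _ := by ring

lemma repr_formula {n : ℕ} (hn : 1 ≤ n) {s : ℝ} (hs0 : 0 < s) (hs1 : s < 1) :
    ∃ K : ℝ, 0 < K ∧ ∀ u : EE n → ℝ, ContDiff ℝ (⊤ : ℕ∞) u → HasCompactSupport u → ∀ x,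
      IntegrableOn (fun ρ : ℝ => ρ ^ (s - n - 2) * AA n s u (ρ ^ 2)⁻¹ x) (Set.Ioi 0) ∧
      ∫ ρ in Set.Ioi (0 : ℝ), ρ ^ (s - n - 2) * AA n s u (ρ ^ 2)⁻¹ x = K * u x := by
  obtain ⟨c, hc0, hcM⟩ := symM hn hs0 hs1
  set K0 : ℝ := Real.pi ^ (-(s + 1) / 2) * (1 / 2) * Real.Gamma ((s + 1) / 2) with hK0
  have hK0p : 0 < K0 := by
    have := Real.Gamma_pos_of_pos (by linarith : 0 < (s + 1) / 2)
    positivity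
  refine ⟨c * K0, by positivity, fun u hu hc x => ?_⟩
  obtain ⟨f, hf⟩ := fourier_data u hu hc
  have hec := ee_cont.measurable
  have hfm := hf.cont.measurable
  let G : ℝ → EE n → ℂ := fun ρ ξ => (ee (inner ℝ ξ x) * f ξ) *
    ((‖ξ‖ ^ (s + 1) * (ρ ^ s * Real.exp (-(Real.pi * ‖ξ‖ ^ 2) * ρ ^ (2 : ℝ))) : ℝ) : ℂ)
  have hA : ∀ ρ ∈ Set.Ioi (0 : ℝ), ((ρ ^ (s - n - 2) * AA n s u (ρ ^ 2)⁻¹ x : ℝ) : ℂ) =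
      (c : ℂ) * ∫ ξ, G ρ ξ := by
    intro ρ hρ
    have hρ : 0 < ρ := hρ
    rw [Complex.ofReal_mul, AA_formula hn hs0 hs1 u hu hc hf (by positivity) x,
      ← integral_const_mul, ← integral_const_mul, ← integral_const_mul]
    congr 1; ext ξ
    rw [hcM]
    have e1 : ((ρ ^ 2)⁻¹) ^ (-((n : ℝ) / 2) - 1) = ρ ^ ((n : ℝ) + 2) := by
      rw [← Real.rpow_natCast, ← Real.rpow_neg hρ.le, ← Real.rpow_mul hρ.le]
      congr 1; push_cast; ring
    have e2 : ρ ^ s = ρ ^ (s - n - 2) * ρ ^ ((n : ℝ) + 2) := by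
      rw [← Real.rpow_add hρ]; congr 1; ring
    have e3 : -(Real.pi * ‖ξ‖ ^ 2 / (ρ ^ 2)⁻¹) = -(Real.pi * ‖ξ‖ ^ 2) * ρ ^ (2 : ℝ) := by
      rw [div_inv_eq_mul, Real.rpow_two]; ring
    simp only [G]
    rw [e1, e2, e3]
    push_cast
    ring_nf
    rw [Complex.I_sq]
    ring
  have hg : ∀ ξ : EE n, ξ ≠ 0 → ‖ξ‖ ^ (s + 1) *
      ∫ ρ in Set.Ioi (0 : ℝ), ρ ^ s * Real.exp (-(Real.pi * ‖ξ‖ ^ 2) * ρ ^ (2 : ℝ)) = K0 := by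
    intro ξ hξ
    have hp : 0 < ‖ξ‖ := norm_pos_iff.mpr hξ
    rw [integral_rpow_mul_exp_neg_mul_rpow two_pos (by linarith) (by positivity),
      Real.mul_rpow (by positivity) (by positivity), ← Real.rpow_natCast, ← Real.rpow_mul hp.le]
    have : ‖ξ‖ ^ (s + 1) * ‖ξ‖ ^ (((2 : ℕ) : ℝ) * (-(s + 1) / 2)) = 1 := by
      rw [← Real.rpow_add hp, ← Real.rpow_zero ‖ξ‖]; congr 1; push_cast; ring
    rw [hK0]
    linear_combination (Real.pi ^ (-(s + 1) / 2) * (1 / 2) * Real.Gamma ((s + 1) / 2)) * this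
  have hgi : ∀ ξ : EE n, ξ ≠ 0 → Integrable (fun ρ => G ρ ξ) (volume.restrict (Set.Ioi 0)) := by
    intro ξ hξ
    have hp : 0 < ‖ξ‖ := norm_pos_iff.mpr hξ
    have h1 := (integrableOn_rpow_mul_exp_neg_mul_rpow (s := s) (p := 2) (b := Real.pi * ‖ξ‖ ^ 2)
      (by linarith) two_pos (by positivity)).const_mul (‖ξ‖ ^ (s + 1))
    have h2 : Integrable (fun ρ : ℝ => ((‖ξ‖ ^ (s + 1) * (ρ ^ s *
      Real.exp (-(Real.pi * ‖ξ‖ ^ 2) * ρ ^ (2 : ℝ))) : ℝ) : ℂ)) (volume.restrict (Set.Ioi 0)) := h1.ofReal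
    exact h2.const_mul (ee (inner ℝ ξ x) * f ξ)
  have hGint : Integrable (Function.uncurry G) ((volume.restrict (Set.Ioi (0 : ℝ))).prod volume) := by
    rw [integrable_prod_iff']
    · constructor
      · filter_upwards [ae_ne_zero hn] with ξ hξ using hgi ξ hξ
      · refine ((f_int hf).norm.mul_const K0).congr ?_
        filter_upwards [ae_ne_zero hn] with ξ hξ
        have : ∀ ρ ∈ Set.Ioi (0 : ℝ), ‖Function.uncurry G (ρ, ξ)‖ = ‖f ξ‖ * (‖ξ‖ ^ (s + 1) * (ρ ^ s *
            Real.exp (-(Real.pi * ‖ξ‖ ^ 2) * ρ ^ (2 : ℝ)))) := by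
          intro ρ hρ
          have hρ : 0 < ρ := hρ
          simp only [G, Function.uncurry_def]
          rw [norm_mul, norm_mul, ee_norm, one_mul, Complex.norm_real, Real.norm_of_nonneg (by positivity)]
        rw [setIntegral_congr_fun measurableSet_Ioi this, integral_const_mul, integral_const_mul, hg ξ hξ]
    · apply Measurable.aestronglyMeasurable
      simp only [G, Function.uncurry_def]
      fun_prop
  have hI : Integrable (fun ρ => (c : ℂ) * ∫ ξ, G ρ ξ) (volume.restrict (Set.Ioi (0 : ℝ))) :=
    hGint.integral_prod_left.const_mul _
  constructor
  · refine hI.re.congr ?_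
    filter_upwards [ae_restrict_mem measurableSet_Ioi] with ρ hρ
    rw [← hA ρ hρ]
    exact Complex.ofReal_re _
  · have : (((∫ ρ in Set.Ioi (0 : ℝ), ρ ^ (s - n - 2) * AA n s u (ρ ^ 2)⁻¹ x) : ℝ) : ℂ) =
        ((c * K0 * u x : ℝ) : ℂ) := by
      rw [← integral_complex_ofReal, setIntegral_congr_fun measurableSet_Ioi hA, integral_const_mul,
        integral_integral_swap hGint]
      have e : ∫ ξ, ∫ ρ in Set.Ioi (0 : ℝ), G ρ ξ = ∫ ξ, (ee (inner ℝ ξ x) * f ξ) * (K0 : ℂ) := by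
        apply integral_congr_ae
        filter_upwards [ae_ne_zero hn] with ξ hξ
        simp only [G]
        rw [integral_const_mul, integral_complex_ofReal, integral_const_mul, hg ξ hξ]
      rw [e, integral_mul_const, ← hf.rep]
      push_cast; ring
    exact_mod_cast this

def gq {n : ℕ} (w : EE n) : ℝ := Real.exp (-(Real.pi / 4 * ‖w‖ ^ 2))

lemma poly_exp {r : ℝ} (hr : 0 ≤ r) :
    (1 + Real.pi * ((r + 1) * (2 * r + 1))) * Real.exp (-(Real.pi * r ^ 2)) ≤
      11 * Real.exp (-(Real.pi / 4 * r ^ 2)) := by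
  have h1 := Real.add_one_le_exp (3 * Real.pi / 4 * r ^ 2)
  have hp3 := Real.pi_gt_three
  have hp4 := Real.pi_lt_four
  have h2 : 1 + Real.pi * ((r + 1) * (2 * r + 1)) ≤ 11 * Real.exp (3 * Real.pi / 4 * r ^ 2) := by
    have h3 : Real.pi * ((r + 1) * (2 * r + 1)) ≤ 4 * ((r + 1) * (2 * r + 1)) := by gcongr
    have h4 : 9 / 4 * r ^ 2 ≤ 3 * Real.pi / 4 * r ^ 2 := by gcongr; linarith
    nlinarith [sq_nonneg (r - 1), sq_nonneg r]
  calc _ ≤ (11 * Real.exp (3 * Real.pi / 4 * r ^ 2)) * Real.exp (-(Real.pi * r ^ 2)) := by gcongr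
    _ = _ := by rw [mul_assoc, ← Real.exp_add]; congr 2; ring

lemma exp_diff (a b : ℝ) :
    |Real.exp (-a) - Real.exp (-b)| ≤ |a - b| * (Real.exp (-a) + Real.exp (-b)) := by
  wlog h : a ≤ b generalizing a b
  · have := this b a (le_of_not_ge h)
    rw [abs_sub_comm, abs_sub_comm a b, add_comm (Real.exp (-a))]; exact this
  have h1 : Real.exp (-b) ≤ Real.exp (-a) := by gcongr
  rw [abs_of_nonneg (by linarith), abs_of_nonpos (by linarith)]
  have h2 := Real.add_one_le_exp (a - b)
  have h3 : Real.exp (-b) = Real.exp (-a) * Real.exp (a - b) := by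
    rw [← Real.exp_add]; congr 1; ring
  have h4 := Real.exp_pos (-a)
  have h5 := Real.exp_pos (-b)
  have h6 : (b - a) * Real.exp (-b) ≥ 0 := mul_nonneg (by linarith) h5.le
  nlinarith

lemma psi_bound0 {n : ℕ} (v : EE n) :
    ‖Real.exp (-(Real.pi * ‖v‖ ^ 2)) • v‖ ≤ 11 * gq v := by
  rw [norm_smul, Real.norm_of_nonneg (by positivity), mul_comm]
  refine le_trans ?_ (poly_exp (norm_nonneg v))
  gcongr
  have := norm_nonneg v
  nlinarith [Real.pi_gt_three, mul_nonneg Real.pi_pos.le this, mul_nonneg Real.pi_pos.le (sq_nonneg ‖v‖)]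

lemma psi_bound {n : ℕ} (v w : EE n) :
    ‖Real.exp (-(Real.pi * ‖v‖ ^ 2)) • v - Real.exp (-(Real.pi * ‖w‖ ^ 2)) • w‖ ≤
      11 * min 1 ‖v - w‖ * (gq v + gq w) := by
  rcases le_total 1 ‖v - w‖ with h | h
  · rw [min_eq_left h]
    refine (norm_sub_le _ _).trans ?_
    linarith [psi_bound0 v, psi_bound0 w]
  rw [min_eq_right h]
  have e : Real.exp (-(Real.pi * ‖v‖ ^ 2)) • v - Real.exp (-(Real.pi * ‖w‖ ^ 2)) • w =
    Real.exp (-(Real.pi * ‖v‖ ^ 2)) • (v - w) +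
      (Real.exp (-(Real.pi * ‖v‖ ^ 2)) - Real.exp (-(Real.pi * ‖w‖ ^ 2))) • w := by
    rw [smul_sub, sub_smul]; abel
  rw [e]
  refine (norm_add_le _ _).trans ?_
  rw [norm_smul, norm_smul, Real.norm_of_nonneg (Real.exp_pos _).le, Real.norm_eq_abs]
  have h1 := exp_diff (Real.pi * ‖v‖ ^ 2) (Real.pi * ‖w‖ ^ 2)
  have h2 := abs_norm_sub_norm_le v w
  have hv := poly_exp (norm_nonneg v)
  have hw := poly_exp (norm_nonneg w)
  unfold gq
  have nv := norm_nonneg v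
  have nw := norm_nonneg w
  have nd := norm_nonneg (v - w)
  generalize ‖v - w‖ = d at *
  generalize ‖v‖ = a at *
  generalize ‖w‖ = b at *
  have hpi := Real.pi_pos
  have h3 : |Real.pi * a ^ 2 - Real.pi * b ^ 2| ≤ Real.pi * (d * (a + b)) := by
    have : Real.pi * a ^ 2 - Real.pi * b ^ 2 = Real.pi * ((a - b) * (a + b)) := by ring
    rw [this, abs_mul, abs_mul, abs_of_pos hpi, abs_of_nonneg (by positivity : 0 ≤ a + b)]
    gcongr
  have hEa := Real.exp_pos (-(Real.pi * a ^ 2))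
  have hEb := Real.exp_pos (-(Real.pi * b ^ 2))
  generalize Real.exp (-(Real.pi * a ^ 2)) = Ea at *
  generalize Real.exp (-(Real.pi * b ^ 2)) = Eb at *
  generalize Real.exp (-(Real.pi / 4 * a ^ 2)) = Ga at *
  generalize Real.exp (-(Real.pi / 4 * b ^ 2)) = Gb at *
  have hab := (abs_le.1 h2)
  have k1 : (a + b) * b ≤ (a + 1) * (2 * a + 1) := by nlinarith
  have k2 : (a + b) * b ≤ (b + 1) * (2 * b + 1) := by nlinarith
  calc Ea * d + |Ea - Eb| * b ≤ Ea * d + (Real.pi * (d * (a + b)) * (Ea + Eb)) * b := by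
        gcongr
        exact h1.trans (by gcongr)
    _ = d * ((1 + Real.pi * ((a + b) * b)) * Ea + (Real.pi * ((a + b) * b)) * Eb) := by ring
    _ ≤ d * ((1 + Real.pi * ((a + 1) * (2 * a + 1))) * Ea + (1 + Real.pi * ((b + 1) * (2 * b + 1))) * Eb) := by
        gcongr
        linarith [mul_le_mul_of_nonneg_left k2 hpi.le]
    _ ≤ d * (11 * Ga + 11 * Gb) := by gcongr
    _ = _ := by ring

lemma psi_scale {n : ℕ} {ρ : ℝ} (hρ : 0 < ρ) (w : EE n) :
    Real.exp (-(Real.pi * (ρ ^ 2)⁻¹ * ‖w‖ ^ 2)) • w =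
      ρ • (Real.exp (-(Real.pi * ‖ρ⁻¹ • w‖ ^ 2)) • (ρ⁻¹ • w)) := by
  rw [smul_comm ρ, smul_inv_smul₀ hρ.ne', norm_smul, norm_inv, Real.norm_of_nonneg hρ.le]
  congr 3; ring

lemma psi_scaled_bound {n : ℕ} {ρ : ℝ} (hρ : 0 < ρ) (v w : EE n) :
    ‖Real.exp (-(Real.pi * (ρ ^ 2)⁻¹ * ‖v‖ ^ 2)) • v - Real.exp (-(Real.pi * (ρ ^ 2)⁻¹ * ‖w‖ ^ 2)) • w‖ ≤
      11 * ρ * min 1 (‖v - w‖ / ρ) * (gq (ρ⁻¹ • v) + gq (ρ⁻¹ • w)) := by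
  rw [psi_scale hρ, psi_scale hρ, ← smul_sub, norm_smul, Real.norm_of_nonneg hρ.le]
  have := psi_bound (ρ⁻¹ • v) (ρ⁻¹ • w)
  have e : ‖ρ⁻¹ • v - ρ⁻¹ • w‖ = ‖v - w‖ / ρ := by
    rw [← smul_sub ρ⁻¹ v w, norm_smul ρ⁻¹, norm_inv, Real.norm_of_nonneg hρ.le, ← div_eq_inv_mul]
  rw [e] at this
  calc _ ≤ ρ * (11 * min 1 (‖v - w‖ / ρ) * (gq (ρ⁻¹ • v) + gq (ρ⁻¹ • w))) := by gcongr
    _ = _ := by ring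

lemma psi_scaled_bound0 {n : ℕ} {ρ : ℝ} (hρ : 0 < ρ) (v : EE n) :
    ‖Real.exp (-(Real.pi * (ρ ^ 2)⁻¹ * ‖v‖ ^ 2)) • v‖ ≤ 11 * ρ * gq (ρ⁻¹ • v) := by
  rw [psi_scale hρ, norm_smul, Real.norm_of_nonneg hρ.le]
  have := psi_bound0 (ρ⁻¹ • v)
  calc _ ≤ ρ * (11 * gq (ρ⁻¹ • v)) := by gcongr
    _ = _ := by ring

lemma gq_pow_int {n : ℕ} {ρ q : ℝ} (hρ : 0 < ρ) (hq : 0 < q) (x : EE n) :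
    Integrable (fun z => gq (ρ⁻¹ • (x - z)) ^ q) ∧
    ∫ z, gq (ρ⁻¹ • (x - z)) ^ q = (4 / q) ^ ((n : ℝ) / 2) * ρ ^ (n : ℝ) := by
  have hb : 0 < Real.pi / 4 * q * (ρ ^ 2)⁻¹ := by positivity
  have e : ∀ w : EE n, gq (ρ⁻¹ • w) ^ q = Real.exp (-(Real.pi / 4 * q * (ρ ^ 2)⁻¹) * ‖w‖ ^ 2) := by
    intro w
    rw [gq, ← Real.exp_mul, norm_smul, norm_inv, Real.norm_of_nonneg hρ.le]
    congr 1; ring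
  constructor
  · have := (gauss_int (n := n) hb).comp_sub_left x
    refine this.congr (Eventually.of_forall fun z => ?_)
    simp only [e, neg_mul]
  · rw [integral_sub_left_eq_self (fun w : EE n => gq (ρ⁻¹ • w) ^ q) volume x]
    simp only [e]
    have := GaussianFourier.integral_rexp_neg_mul_sq_norm (V := EE n) hb
    rw [this]
    have e2 : Real.pi / (Real.pi / 4 * q * (ρ ^ 2)⁻¹) = (4 / q) * ρ ^ 2 := by
      field_simp
    rw [e2, Real.mul_rpow (by positivity) (by positivity), ← Real.rpow_natCast ρ 2, ← Real.rpow_mul hρ.le]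
    simp only [finrank_euclideanSpace, Fintype.card_fin]
    congr 2; push_cast; ring

lemma gq_memLp {n : ℕ} {ρ q : ℝ} (hρ : 0 < ρ) (hq : 0 < q) (x : EE n) :
    MemLp (fun z => gq (ρ⁻¹ • (x - z))) (ENNReal.ofReal q) := by
  have hm : AEStronglyMeasurable (fun z : EE n => gq (ρ⁻¹ • (x - z))) := by
    unfold gq; fun_prop
  rw [← integrable_norm_rpow_iff hm (by simpa using hq) (by simp)]
  refine (gq_pow_int hρ hq x).1.congr (Eventually.of_forall fun z => ?_)
  simp only [ENNReal.toReal_ofReal hq.le]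
  rw [Real.norm_of_nonneg (by unfold gq; positivity)]

lemma holder_gq {n : ℕ} {p q : ℝ} (hpq : p.HolderConjugate q) {F : EE n → EE n}
    (hF : MemLp F (ENNReal.ofReal p)) {ρ : ℝ} (hρ : 0 < ρ) (x : EE n) :
    Integrable (fun z => ‖F z‖ * gq (ρ⁻¹ • (x - z))) ∧
    ∫ z, ‖F z‖ * gq (ρ⁻¹ • (x - z)) ≤
      (eLpNorm F (ENNReal.ofReal p)).toReal * ((4 / q) ^ ((n : ℝ) / 2)) ^ (1 / q) * ρ ^ ((n : ℝ) / q) := by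
  have hp := hpq.pos
  have hq := hpq.symm.pos
  have hG := gq_memLp hρ hq x
  have hc : ENNReal.HolderConjugate (ENNReal.ofReal p) (ENNReal.ofReal q) := hpq.ennrealOfReal
  refine ⟨MemLp.integrable_mul hF.norm hG, ?_⟩
  have h := integral_mul_le_Lp_mul_Lq_of_nonneg hpq (Eventually.of_forall fun z => norm_nonneg (F z))
    (Eventually.of_forall fun z => by simp only [gq, Pi.zero_apply]; positivity) hF.norm hG
  refine h.trans (le_of_eq ?_)
  rw [(gq_pow_int hρ hq x).2, hF.eLpNorm_eq_integral_rpow_norm (by simpa using hp) (by simp),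
    ENNReal.toReal_ofReal (by positivity), ENNReal.toReal_ofReal hp.le, one_div p,
    Real.mul_rpow (by positivity) (by positivity), ← Real.rpow_mul hρ.le, mul_one_div (n : ℝ) q]
  ring

lemma AA_diff {n : ℕ} {s p q : ℝ} (hpq : p.HolderConjugate q) (u : EE n → ℝ)
    (hF : MemLp (D0 n s u) (ENNReal.ofReal p)) {ρ : ℝ} (hρ : 0 < ρ) (x y : EE n) :
    |AA n s u (ρ ^ 2)⁻¹ x - AA n s u (ρ ^ 2)⁻¹ y| ≤
      (22 * ((eLpNorm (D0 n s u) (ENNReal.ofReal p)).toReal * ((4 / q) ^ ((n : ℝ) / 2)) ^ (1 / q))) *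
       (ρ * min 1 (‖x - y‖ / ρ) * ρ ^ ((n : ℝ) / q)) := by
  have e : ∀ x z : EE n, inner ℝ (D0 n s u z) (x - z) * Real.exp (-(Real.pi * (ρ ^ 2)⁻¹ * ‖x - z‖ ^ 2))
      = inner ℝ (D0 n s u z) (Real.exp (-(Real.pi * (ρ ^ 2)⁻¹ * ‖x - z‖ ^ 2)) • (x - z)) := by
    intro x z; rw [inner_smul_right]; ring
  have hm := hF.1
  have hI : ∀ x : EE n, Integrable (fun z =>
      inner ℝ (D0 n s u z) (Real.exp (-(Real.pi * (ρ ^ 2)⁻¹ * ‖x - z‖ ^ 2)) • (x - z))) := by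
    intro x
    refine ((holder_gq hpq hF hρ x).1.const_mul (11 * ρ)).mono' ?_ (Eventually.of_forall fun z => ?_)
    · exact hm.inner (by fun_prop)
    · refine (norm_inner_le_norm _ _).trans ?_
      calc _ ≤ ‖D0 n s u z‖ * (11 * ρ * gq (ρ⁻¹ • (x - z))) := by
            gcongr; exact psi_scaled_bound0 hρ _
        _ = _ := by ring
  unfold AA
  simp only [e]
  rw [← integral_sub (hI x) (hI y), ← Real.norm_eq_abs]
  have hx := holder_gq hpq hF hρ x
  have hy := holder_gq hpq hF hρ y
  refine (norm_integral_le_of_norm_le ((hx.1.add hy.1).const_mul (11 * ρ * min 1 (‖x - y‖ / ρ)))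
    (Eventually.of_forall fun z => ?_)).trans ?_
  · simp only [Pi.add_apply]
    rw [← inner_sub_right]
    refine (norm_inner_le_norm _ _).trans ?_
    have := psi_scaled_bound hρ (x - z) (y - z)
    rw [sub_sub_sub_cancel_right] at this
    calc _ ≤ ‖D0 n s u z‖ * (11 * ρ * min 1 (‖x - y‖ / ρ) * (gq (ρ⁻¹ • (x - z)) + gq (ρ⁻¹ • (y - z)))) := by
            gcongr
      _ = _ := by ring
  · rw [integral_const_mul]
    simp only [Pi.add_apply]
    rw [integral_add hx.1 hy.1]
    have := mul_le_mul_of_nonneg_left (add_le_add hx.2 hy.2)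
      (by positivity : 0 ≤ 11 * ρ * min 1 (‖x - y‖ / ρ))
    refine this.trans (le_of_eq ?_)
    ring

lemma holder_est {n : ℕ} (hn : 1 ≤ n) {s p : ℝ} (hs0 : 0 < s) (hs1 : s < 1)
    (hp : 1 < p) (hsp : (n : ℝ) < s * p) :
    ∃ C : ℝ, 0 < C ∧ ∀ u : EE n → ℝ, ContDiff ℝ (⊤ : ℕ∞) u → HasCompactSupport u →
      MemLp (D0 n s u) (ENNReal.ofReal p) → ∀ x y : EE n,
      |u x - u y| ≤ C * (eLpNorm (D0 n s u) (ENNReal.ofReal p)).toReal * ‖x - y‖ ^ (s - n / p) := by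
  obtain ⟨K, hK, hrep⟩ := repr_formula hn hs0 hs1
  have hpq := Real.HolderConjugate.conjExponent hp
  set q := p.conjExponent
  have hq := hpq.symm.pos
  have hp0 := hpq.pos
  have hμ0 : 0 < s - n / p := by
    rw [sub_pos, div_lt_iff₀ hp0]; exact hsp
  have hμ1 : s - n / p < 1 := by
    have : 0 ≤ (n : ℝ) / p := by positivity
    linarith
  set μ := s - n / p with hμ
  set G := ((4 / q) ^ ((n : ℝ) / 2)) ^ (1 / q) with hG
  have hGpos : 0 < G := by positivity
  have h1μ : 0 < 1 - μ := by linarith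
  refine ⟨K⁻¹ * (22 * G) * (1 / μ + 1 / (1 - μ)), by positivity, fun u hu hc hF x y => ?_⟩
  by_cases hxy : x = y
  · subst hxy; simp; positivity
  have hd : 0 < ‖x - y‖ := norm_pos_iff.2 (sub_ne_zero.2 hxy)
  obtain ⟨ix, ex⟩ := hrep u hu hc x
  obtain ⟨iy, ey⟩ := hrep u hu hc y
  obtain ⟨im, em⟩ := minint hμ0 hμ1 hd
  set N := (eLpNorm (D0 n s u) (ENNReal.ofReal p)).toReal
  have key : |K * u x - K * u y| ≤ 22 * (N * G) * (‖x - y‖ ^ μ * (1 / μ + 1 / (1 - μ))) := by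
    rw [← ex, ← ey, ← integral_sub ix iy, ← em, ← integral_const_mul, ← Real.norm_eq_abs]
    refine norm_integral_le_of_norm_le (im.const_mul _) ?_
    refine (ae_restrict_iff' measurableSet_Ioi).2 (Eventually.of_forall fun ρ hρ => ?_)
    have hρ : 0 < ρ := hρ
    rw [← mul_sub, norm_mul, Real.norm_of_nonneg (by positivity), Real.norm_eq_abs]
    have e1 : ρ ^ (μ - 1) = ρ ^ (s - n - 2) * (ρ * ρ ^ ((n : ℝ) / q)) := by
      nth_rewrite 3 [← Real.rpow_one ρ]
      rw [← Real.rpow_add hρ, ← Real.rpow_add hρ]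
      congr 1
      have : (1 : ℝ) / q = 1 - 1 / p := by
        have := hpq.inv_add_inv_eq_one
        rw [one_div, one_div]; linarith
      rw [div_eq_mul_one_div (n : ℝ) q, this, hμ]
      ring
    calc _ ≤ ρ ^ (s - n - 2) * ((22 * (N * G)) * (ρ * min 1 (‖x - y‖ / ρ) * ρ ^ ((n : ℝ) / q))) := by
          gcongr; exact AA_diff hpq u hF hρ x y
      _ = _ := by rw [e1]; ring
  rw [← mul_sub, abs_mul, abs_of_pos hK] at key
  have : |u x - u y| = K⁻¹ * (K * |u x - u y|) := by field_simp
  rw [this]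
  calc _ ≤ K⁻¹ * (22 * (N * G) * (‖x - y‖ ^ μ * (1 / μ + 1 / (1 - μ)))) := by gcongr
    _ = _ := by ring

lemma D0_meas {n : ℕ} (s : ℝ) (u : EE n → ℝ) (hu : Continuous u) :
    StronglyMeasurable (D0 n s u) := by
  have hum := hu.measurable
  unfold D0
  apply StronglyMeasurable.integral_prod_right
    (f := fun z h : EE n => ((u z - u (z - h)) / ‖h‖ ^ ((n : ℝ) + s + 1)) • h)
  apply Measurable.stronglyMeasurable
  simp only [Function.uncurry_def]
  fun_prop

lemma sup_est {n : ℕ} {p : ℝ} (hp : 1 < p) :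
    ∃ B : ℝ, 0 < B ∧ ∀ u : EE n → ℝ, Continuous u → ∀ M : ℝ, 0 ≤ M →
      (∀ x y, ‖x - y‖ ≤ 1 → |u x - u y| ≤ M) → ∀ x,
      ENNReal.ofReal |u x| ≤ ENNReal.ofReal B * eLpNorm u (ENNReal.ofReal p) + ENNReal.ofReal M := by
  have hp0 : 0 < p := by linarith
  set V := volume (Metric.ball (0 : EE n) 1) with hV
  have hV0 : V ≠ 0 := (Metric.measure_ball_pos volume _ one_pos).ne'
  have hVt : V ≠ ⊤ := measure_ball_lt_top.ne
  have hW0 : V ^ (1 / p) ≠ 0 := by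
    simp [ENNReal.rpow_eq_zero_iff, hV0, hVt]
  have hWt : V ^ (1 / p) ≠ ⊤ := by
    simp [ENNReal.rpow_eq_top_iff, hV0, hVt]
  refine ⟨((V ^ (1 / p))⁻¹).toReal, ENNReal.toReal_pos (by simpa using hWt) (by simpa using hW0),
    fun u hu M hM h x => ?_⟩
  rw [ENNReal.ofReal_toReal (by simpa using hW0)]
  set ν := volume.restrict (Metric.ball x 1)
  have hνV : ν Set.univ = V := by
    rw [Measure.restrict_apply_univ, hV, Measure.addHaar_ball_center]
  have hν0 : ν ≠ 0 := by
    intro h0; rw [h0] at hνV; exact hV0 (by simpa using hνV.symm)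
  have hpe : ENNReal.ofReal p ≠ 0 := by simpa using hp0
  have h1 : eLpNorm (fun _ : EE n => |u x|) (ENNReal.ofReal p) ν ≤
      eLpNorm u (ENNReal.ofReal p) ν + eLpNorm (fun _ : EE n => M) (ENNReal.ofReal p) ν := by
    rw [← eLpNorm_norm u]
    refine le_trans ?_ (eLpNorm_add_le (hu.norm.aestronglyMeasurable) (by fun_prop)
      (by rw [← ENNReal.ofReal_one]; exact ENNReal.ofReal_le_ofReal hp.le))
    refine eLpNorm_mono_ae ((ae_restrict_iff' measurableSet_ball).2 (Eventually.of_forall fun y hy => ?_))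
    have h2 := h x y (by rw [← dist_eq_norm, dist_comm]; exact (Metric.mem_ball.1 hy).le)
    simp only [Pi.add_apply, Real.norm_eq_abs, abs_abs]
    have h5 := le_abs_self (|u y| + M)
    have := abs_sub_abs_le_abs_sub (u x) (u y)
    linarith
  have h3 : eLpNorm u (ENNReal.ofReal p) ν ≤ eLpNorm u (ENNReal.ofReal p) volume :=
    eLpNorm_mono_measure _ Measure.restrict_le_self
  rw [eLpNorm_const _ hpe hν0, eLpNorm_const _ hpe hν0, hνV, ENNReal.toReal_ofReal hp0.le,
    Real.enorm_eq_ofReal (abs_nonneg _), Real.enorm_eq_ofReal hM] at h1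
  have h4 := h1.trans (add_le_add h3 le_rfl)
  set W := V ^ (1 / p)
  calc ENNReal.ofReal |u x| = W⁻¹ * (ENNReal.ofReal |u x| * W) := by
        rw [mul_comm _ W, ← mul_assoc, ENNReal.inv_mul_cancel hW0 hWt, one_mul]
    _ ≤ W⁻¹ * (eLpNorm u (ENNReal.ofReal p) volume + ENNReal.ofReal M * W) := by gcongr
    _ = _ := by
        rw [mul_add, mul_comm _ W, ← mul_assoc W⁻¹ W, ENNReal.inv_mul_cancel hW0 hWt, one_mul]

lemma cns_pos {n : ℕ} (hn : 1 ≤ n) {s : ℝ} (hs0 : 0 < s) (hs1 : s < 1) : 0 < cns n s := by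
  have hn' : (1 : ℝ) ≤ n := by exact_mod_cast hn
  have h1 : 0 < (n : ℝ) + s - 1 := by linarith
  have h2 : 0 < Real.Gamma (((n : ℝ) + s - 1) / 2) := Real.Gamma_pos_of_pos (by linarith)
  have h3 : 0 < Real.Gamma ((1 - s) / 2) := Real.Gamma_pos_of_pos (by linarith)
  unfold cns
  positivity

lemma rieszGrad_eq (n : ℕ) (s : ℝ) (u : EE n → ℝ) : rieszGrad n s u = cns n s • D0 n s u := by
  ext1 x
  rw [rieszGrad, Pi.smul_apply, D0]
  congr 1
  rw [← integral_sub_left_eq_self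
    (fun h : EE n => ((u x - u (x - h)) / ‖h‖ ^ ((n : ℝ) + s + 1)) • h) volume x]
  simp only [_root_.sub_sub_cancel]

/-- Fractional Morrey inequality: continuous embedding
`H^{s,p}(ℝⁿ) ↪ C^{0,μ_s}(ℝⁿ)` in the supercritical case `sp > n`, with
`μ_s = s - n/p`.  The left-hand side is
`sup_{x} |u x| + sup_{x ≠ y} |u x - u y|/|x - y|^{μ_s}`, expressed in `ℝ≥0∞`. -/
theorem bessel_morrey_inequality_supercritical
    (n : ℕ) (hn : 1 ≤ n) (s p : ℝ) (hs0 : 0 < s) (hs1 : s < 1)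
    (hp : 1 < p) (hsp : (n : ℝ) < s * p) :
    ∃ C : ℝ, 0 < C ∧ ∀ u : EuclideanSpace ℝ (Fin n) → ℝ,
      ContDiff ℝ (⊤ : ℕ∞) u → HasCompactSupport u →
      (⨆ x : EuclideanSpace ℝ (Fin n), ENNReal.ofReal |u x|) +
        (⨆ x : EuclideanSpace ℝ (Fin n), ⨆ y : EuclideanSpace ℝ (Fin n),
          ⨆ _ : x ≠ y, ENNReal.ofReal (|u x - u y| / ‖x - y‖ ^ (s - n / p))) ≤
      ENNReal.ofReal C * (eLpNorm u (ENNReal.ofReal p) volume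
        + eLpNorm (rieszGrad n s u) (ENNReal.ofReal p) volume) := by
  have hp0 : 0 < p := by linarith
  obtain ⟨A, hA, hhold⟩ := holder_est hn hs0 hs1 hp hsp
  obtain ⟨B, hB, hsup⟩ := sup_est (n := n) hp
  have hc0 := cns_pos hn hs0 hs1
  set A' := A * (cns n s)⁻¹ with hA'
  have hA'0 : 0 < A' := by positivity
  refine ⟨B + 2 * A', by positivity, fun u hu hcs => ?_⟩
  have hR := rieszGrad_eq n s u
  have hN : eLpNorm (rieszGrad n s u) (ENNReal.ofReal p) volume =
      ENNReal.ofReal (cns n s) * eLpNorm (D0 n s u) (ENNReal.ofReal p) volume := by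
    rw [hR, eLpNorm_const_smul, Real.enorm_eq_ofReal hc0.le]
  by_cases htop : eLpNorm (D0 n s u) (ENNReal.ofReal p) volume = ⊤
  · rw [hN, htop, ENNReal.mul_top (by simpa using hc0), add_top, ENNReal.mul_top]
    · exact le_top
    · simp only [ne_eq, ENNReal.ofReal_eq_zero, not_le]; positivity
  have hF : MemLp (D0 n s u) (ENNReal.ofReal p) :=
    ⟨(D0_meas s u hu.continuous).aestronglyMeasurable, lt_top_iff_ne_top.2 htop⟩
  have hh := hhold u hu hcs hF
  set N := (eLpNorm (D0 n s u) (ENNReal.ofReal p) volume).toReal with hNdef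
  have hN0 : 0 ≤ N := ENNReal.toReal_nonneg
  have hμ0 : 0 < s - n / p := by
    rw [sub_pos, div_lt_iff₀ hp0]; exact hsp
  have eN : ENNReal.ofReal (A * N) = ENNReal.ofReal A' * eLpNorm (rieszGrad n s u) (ENNReal.ofReal p) volume := by
    rw [hN, ← ENNReal.ofReal_toReal htop, ← hNdef, ← ENNReal.ofReal_mul hc0.le,
      ← ENNReal.ofReal_mul hA'0.le]
    congr 1
    rw [hA']; field_simp
  have h1 := hsup u hu.continuous (A * N) (by positivity) (fun x y hxy => by
    refine (hh x y).trans ?_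
    have : ‖x - y‖ ^ (s - n / p) ≤ 1 := Real.rpow_le_one (norm_nonneg _) hxy hμ0.le
    exact mul_le_of_le_one_right (by positivity) this)
  have h2 : ∀ x y : EuclideanSpace ℝ (Fin n), x ≠ y →
      ENNReal.ofReal (|u x - u y| / ‖x - y‖ ^ (s - n / p)) ≤ ENNReal.ofReal (A * N) := by
    intro x y hxy
    have hd : 0 < ‖x - y‖ := norm_pos_iff.2 (sub_ne_zero.2 hxy)
    apply ENNReal.ofReal_le_ofReal
    rw [div_le_iff₀ (by positivity)]
    exact hh x y
  have h3 := add_le_add (iSup_le h1) (iSup_le fun x => iSup_le fun y => iSup_le fun hxy => h2 x y hxy)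
  refine h3.trans ?_
  rw [eN]
  set P := eLpNorm u (ENNReal.ofReal p) volume
  set Q := eLpNorm (rieszGrad n s u) (ENNReal.ofReal p) volume
  rw [ENNReal.ofReal_add hB.le (by positivity), ENNReal.ofReal_mul (p := 2) (by norm_num)]
  have e2 : ENNReal.ofReal 2 = 2 := by simp
  rw [e2]
  calc ENNReal.ofReal B * P + ENNReal.ofReal A' * Q + ENNReal.ofReal A' * Q
      = ENNReal.ofReal B * P + 2 * ENNReal.ofReal A' * Q := by ring
    _ ≤ (ENNReal.ofReal B + 2 * ENNReal.ofReal A') * P + (ENNReal.ofReal B + 2 * ENNReal.ofReal A') * Q := by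
        gcongr
        · exact le_self_add
        · exact le_add_self
    _ = _ := by ring


end
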